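/- arXiv:2107.03263 — 7 statements merged into one kernel-verified Lean document; each statement's English description precedes it below -/
import Mathlib

section
/- Let c > 0 and 0 ≤ ξ < c be real numbers. Let μ_i, μ_j, X_i, X_j be real numbers satisfying c ≤ μ_i ≤ 1 − c, c ≤ μ_j ≤ 1, |X_i − μ_i| ≤ ξ and |X_j − μ_j| ≤ ξ. Then μ_i/μ_j − ξ/(c·(c+ξ)) ≤ X_i/X_j ≤ μ_i/μ_j + ξ/(c·(c−ξ)). -/
/-- Deterministic core of the ratio-concentration lemma (Lemma 5.1 of Cayci et al.):
if `μi, μj ≥ c`, `μi ≤ 1 - c`, `μj ≤ 1`, and `Xi, Xj` are within `ξ` of `μi, μj`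
respectively with `0 ≤ ξ < c`, then the empirical ratio `Xi / Xj` lies within the
stated interval around the true ratio `μi / μj`. -/
theorem stmt_0 (c ξ μi μj Xi Xj : ℝ)
    (hc : 0 < c) (hξ0 : 0 ≤ ξ) (hξc : ξ < c)
    (hμi_lb : c ≤ μi) (hμi_ub : μi ≤ 1 - c)
    (hμj_lb : c ≤ μj) (hμj_ub : μj ≤ 1)
    (hXi : |Xi - μi| ≤ ξ) (hXj : |Xj - μj| ≤ ξ) :
    μi / μj - ξ / (c * (c + ξ)) ≤ Xi / Xj ∧
      Xi / Xj ≤ μi / μj + ξ / (c * (c - ξ)) := by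
  obtain ⟨hXi₁, hXi₂⟩ := abs_le.mp hXi
  obtain ⟨hXj₁, hXj₂⟩ := abs_le.mp hXj
  have hμj : 0 < μj := hc.trans_le hμj_lb
  have hratio : μi / μj + 1 ≤ 1 / c := by
    have h : μi / μj ≤ (1 - c) / c := by gcongr; linarith
    have h' : (1 - c) / c + 1 = 1 / c := by field_simp; ring
    linarith
  have hcξ : 0 < c - ξ := sub_pos.mpr hξc
  have hμjξ : 0 < μj - ξ := by linarith
  constructor
  · have hX : (μi - ξ) / (μj + ξ) ≤ Xi / Xj := by
      apply div_le_div₀ <;> linarith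
    have hid : (μi - ξ) / (μj + ξ) = μi / μj - ξ * (μi / μj + 1) / (μj + ξ) := by
      field_simp
      ring
    have hb : ξ * (μi / μj + 1) / (μj + ξ) ≤ ξ * (1 / c) / (c + ξ) := by gcongr
    have he : ξ * (1 / c) / (c + ξ) = ξ / (c * (c + ξ)) := by field_simp
    linarith
  · have hX : Xi / Xj ≤ (μi + ξ) / (μj - ξ) := by
      apply div_le_div₀ <;> linarith
    have hid : (μi + ξ) / (μj - ξ) = μi / μj + ξ * (μi / μj + 1) / (μj - ξ) := by
      field_simp
      ring
    have hb : ξ * (μi / μj + 1) / (μj - ξ) ≤ ξ * (1 / c) / (c - ξ) := by gcongr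
    have he : ξ * (1 / c) / (c - ξ) = ξ / (c * (c - ξ)) := by field_simp
    linarith
end

section
/- Let ȳ : X × V → [0,1], let μ_i = E_i[ȳ], and let ε ∈ (0,1). Let η be the least real number a such that P_i(r > a) ≤ ε/2 (the minimum exists since r takes finitely many values). Then the clipped importance-sampling mean satisfies E_j[ȳ · r · 1{r ≤ η}] ≤ μ_i ≤ E_j[ȳ · r · 1{r ≤ η}] + ε/2. -/
/-- Bias bound for the clipped importance-sampling estimator with full information
(Lemma on the two-armed estimator): if `η` is the least `(ε/2)`-clipping level for the
importance-sampling ratio `r = πi/πj` under expert `i`, then the clipped mean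
`E_j[ȳ·r·1{r ≤ η}]` underestimates `μ_i = E_i[ȳ]` by at most `ε/2`. -/
theorem stmt_3 {X V : Type*} [Fintype X] [Fintype V] [Nonempty X] [Nonempty V]
    (p : X → ℝ) (hp : ∀ x, 0 < p x) (hp1 : ∑ x, p x = 1)
    (πi πj : X → V → ℝ)
    (hπi0 : ∀ x v, 0 ≤ πi x v) (hπi1 : ∀ x, ∑ v, πi x v = 1)
    (hπj0 : ∀ x v, 0 < πj x v) (hπj1 : ∀ x, ∑ v, πj x v = 1)
    (r : V × X → ℝ) (hr : ∀ v x, r (v, x) = πi x v / πj x v)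
    (ybar : X × V → ℝ) (hy : ∀ x v, ybar (x, v) ∈ Set.Icc (0 : ℝ) 1)
    (μi : ℝ) (hμi : μi = ∑ x, p x * ∑ v, πi x v * ybar (x, v))
    (ε : ℝ) (hε : ε ∈ Set.Ioo (0 : ℝ) 1)
    (η : ℝ)
    (hη : IsLeast {a : ℝ |
      ∑ x, p x * ∑ v, πi x v * (if a < r (v, x) then (1 : ℝ) else 0) ≤ ε / 2} η) :
    ∑ x, p x * ∑ v, πj x v *
        (ybar (x, v) * r (v, x) * (if r (v, x) ≤ η then (1 : ℝ) else 0)) ≤ μi ∧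
    μi ≤ (∑ x, p x * ∑ v, πj x v *
        (ybar (x, v) * r (v, x) * (if r (v, x) ≤ η then (1 : ℝ) else 0))) + ε / 2 := by
  have hterm : ∀ x v, πj x v * (ybar (x, v) * r (v, x) * (if r (v, x) ≤ η then (1 : ℝ) else 0)) =
      πi x v * ybar (x, v) * (if r (v, x) ≤ η then (1 : ℝ) else 0) := by
    intro x v
    have hj := (hπj0 x v).ne'
    have hmul : πj x v * r (v, x) = πi x v := by rw [hr, mul_div_cancel₀ _ hj]
    rw [← hmul]
    ring
  simp only [hterm]
  subst hμi
  constructor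
  · refine Finset.sum_le_sum fun x _ => mul_le_mul_of_nonneg_left
      (Finset.sum_le_sum fun v _ => ?_) (hp x).le
    refine mul_le_of_le_one_right (mul_nonneg (hπi0 x v) (hy x v).1) ?_
    split_ifs <;> norm_num
  · refine le_trans ?_ (add_le_add_right hη.1 _)
    rw [← Finset.sum_add_distrib]
    simp only [← mul_add, ← Finset.sum_add_distrib]
    gcongr with x _ v _
    · exact (hp x).le
    · rcases le_or_gt (r (v, x)) η with h | h
      · simp [h, h.not_gt]
      · simpa [h, h.not_ge] using mul_le_of_le_one_right (hπi0 x v) (hy x v).2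
end

section
/- Let ȳ : X × V → [0,1], μ_i = E_i[ȳ], and ε ∈ (0,1). Let r̲, r̄ : V × X → ℝ satisfy r̲(v,x) ≤ r(v,x) ≤ r̄(v,x) for all (v,x). Let η′ be the least real number a such that P_i(r̲ > a) ≤ ε/2, define the estimation error e = max_{(v,x)} ( r̄(v,x) − r̲(v,x)·1{r̄(v,x) ≤ η′} ), and define Ỹ = E_j[ ȳ · r̲ · 1{r̄ ≤ η′} ]. Then μ_i − ε/2 − e ≤ Ỹ ≤ μ_i. -/
/-- Bias bound for the empirical clipped importance-sampling estimator: with lower and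
upper ratio estimates `r̲ ≤ r ≤ r̄`, least clipping level `η'` for `r̲`, estimation error
`e = max_{(v,x)} (r̄ − r̲·1{r̄ ≤ η'})` and estimator mean `Ỹ = E_j[ȳ·r̲·1{r̄ ≤ η'}]`,
one has `μ_i − ε/2 − e ≤ Ỹ ≤ μ_i`. -/
theorem stmt_4 {X V : Type*} [Fintype X] [Fintype V] [Nonempty X] [Nonempty V]
    (p : X → ℝ) (hp : ∀ x, 0 < p x) (hp1 : ∑ x, p x = 1)
    (πi πj : X → V → ℝ)
    (hπi0 : ∀ x v, 0 ≤ πi x v) (hπi1 : ∀ x, ∑ v, πi x v = 1)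
    (hπj0 : ∀ x v, 0 < πj x v) (hπj1 : ∀ x, ∑ v, πj x v = 1)
    (r : V × X → ℝ) (hr : ∀ v x, r (v, x) = πi x v / πj x v)
    (ybar : X × V → ℝ) (hy : ∀ x v, ybar (x, v) ∈ Set.Icc (0 : ℝ) 1)
    (μi : ℝ) (hμi : μi = ∑ x, p x * ∑ v, πi x v * ybar (x, v))
    (ε : ℝ) (hε : ε ∈ Set.Ioo (0 : ℝ) 1)
    (rlow rhigh : V × X → ℝ)
    (hlow : ∀ vx, rlow vx ≤ r vx) (hhigh : ∀ vx, r vx ≤ rhigh vx)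
    (η' : ℝ)
    (hη' : IsLeast {a : ℝ |
      ∑ x, p x * ∑ v, πi x v * (if a < rlow (v, x) then (1 : ℝ) else 0) ≤ ε / 2} η')
    (e : ℝ)
    (he : IsGreatest {y : ℝ | ∃ vx : V × X,
      y = rhigh vx - rlow vx * (if rhigh vx ≤ η' then (1 : ℝ) else 0)} e)
    (Ytilde : ℝ)
    (hY : Ytilde = ∑ x, p x * ∑ v, πj x v *
      (ybar (x, v) * rlow (v, x) * (if rhigh (v, x) ≤ η' then (1 : ℝ) else 0))) :
    μi - ε / 2 - e ≤ Ytilde ∧ Ytilde ≤ μi := by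
  have hπ : ∀ x v, πi x v = πj x v * r (v, x) := fun x v => by
    rw [hr, mul_div_cancel₀ _ (hπj0 x v).ne']
  have hr0 : ∀ x v, 0 ≤ r (v, x) := fun x v => by
    rw [hr]
    exact div_nonneg (hπi0 x v) (hπj0 x v).le
  have hclip : ∀ x v, rlow (v, x) * (if rhigh (v, x) ≤ η' then (1 : ℝ) else 0) ≤ r (v, x) := by
    intro x v
    split_ifs
    · simpa using hlow (v, x)
    · simpa using hr0 x v
  have herr : ∀ x v,
      r (v, x) - rlow (v, x) * (if rhigh (v, x) ≤ η' then (1 : ℝ) else 0) ≤ e := fun x v =>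
    (sub_le_sub_right (hhigh (v, x)) _).trans (he.2 ⟨(v, x), rfl⟩)
  constructor
  · have key : μi ≤ Ytilde + e := by
      have hsum : Ytilde + e = ∑ x, p x * ∑ v, πj x v *
          (ybar (x, v) * rlow (v, x) * (if rhigh (v, x) ≤ η' then (1 : ℝ) else 0) + e) := by
        simp only [mul_add, Finset.sum_add_distrib, ← Finset.sum_mul, hπj1, one_mul, hp1, hY]
      rw [hsum, hμi]
      refine Finset.sum_le_sum fun x _ => mul_le_mul_of_nonneg_left
        (Finset.sum_le_sum fun v _ => ?_) (hp x).le
      rw [hπ, mul_assoc]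
      refine mul_le_mul_of_nonneg_left ?_ (hπj0 x v).le
      have hgap := mul_le_of_le_one_left (sub_nonneg.2 (hclip x v)) (hy x v).2
      linarith [herr x v]
    linarith [hε.1]
  · rw [hY, hμi]
    refine Finset.sum_le_sum fun x _ => mul_le_mul_of_nonneg_left
      (Finset.sum_le_sum fun v _ => ?_) (hp x).le
    rw [hπ, mul_assoc, mul_assoc, mul_comm (r (v, x))]
    exact mul_le_mul_of_nonneg_left
      (mul_le_mul_of_nonneg_left (hclip x v) (hy x v).1) (hπj0 x v).le
end

section
/- Define f₁(x) = x·exp(x−1) − 1, D_{f₁}(i‖j) = E_j[f₁(r)], and M_{ij} = 1 + log(1 + D_{f₁}(i‖j)). Let r̲ : V × X → ℝ satisfy r̲(v,x) ≤ r(v,x) for all (v,x), and let ε ∈ (0,1). Then P_i( r̲ > log(2/ε) + M_{ij} ) ≤ ε/2. Moreover, if ε ≤ 2/e then log(2/ε) + M_{ij} ≤ 2·log(2/ε)·M_{ij}, so also P_i( r̲ > 2·log(2/ε)·M_{ij} ) ≤ ε/2. -/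
/-- If `πi` and `πj` have equal total mass one on each fibre, then
`E_i[exp (πi / πj - 1)] ≥ 1`. -/
theorem one_le_expectation_exp_ratio {X V : Type*} [Fintype X] [Fintype V]
    {p : X → ℝ} (hp : ∀ x, 0 ≤ p x) (hp1 : ∑ x, p x = 1) {πi πj : X → V → ℝ}
    (hπi0 : ∀ x v, 0 ≤ πi x v) (hπi1 : ∀ x, ∑ v, πi x v = 1)
    (hπj0 : ∀ x v, 0 < πj x v) (hπj1 : ∀ x, ∑ v, πj x v = 1) :
    1 ≤ ∑ x, p x * ∑ v, πi x v * Real.exp (πi x v / πj x v - 1) := by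
  have hfibre (x : X) : 1 ≤ ∑ v, πi x v * Real.exp (πi x v / πj x v - 1) :=
    calc (1 : ℝ) = ∑ v, (2 * πi x v - πj x v) := by
          rw [Finset.sum_sub_distrib, ← Finset.mul_sum, hπi1, hπj1]; norm_num
      _ ≤ _ := Finset.sum_le_sum fun v _ => by
          have hexp := Real.add_one_le_exp (πi x v / πj x v - 1)
          rw [sub_add_cancel] at hexp
          refine le_trans ?_ (mul_le_mul_of_nonneg_left hexp (hπi0 x v))
          rw [← mul_div_assoc, le_div_iff₀ (hπj0 x v)]
          nlinarith [sq_nonneg (πi x v - πj x v)]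
  calc (1 : ℝ) = ∑ x, p x * 1 := by simp [hp1]
    _ ≤ _ := Finset.sum_le_sum fun x _ => mul_le_mul_of_nonneg_left (hfibre x) (hp x)

/-- Exponential Markov inequality for a finite weighted double sum. -/
theorem sum_indicator_le_exp_mul_sum {X V : Type*} [Fintype X] [Fintype V]
    {p : X → ℝ} (hp : ∀ x, 0 ≤ p x) {q : X → V → ℝ} (hq : ∀ x v, 0 ≤ q x v)
    {g h : V × X → ℝ} (hgh : ∀ z, g z ≤ h z) (a : ℝ) :
    ∑ x, p x * ∑ v, q x v * (if a < g (v, x) then (1 : ℝ) else 0) ≤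
      Real.exp (1 - a) * ∑ x, p x * ∑ v, q x v * Real.exp (h (v, x) - 1) := by
  simp only [Finset.mul_sum]
  refine Finset.sum_le_sum fun x _ => Finset.sum_le_sum fun v _ => ?_
  have hind : (if a < g (v, x) then (1 : ℝ) else 0) ≤
      Real.exp (1 - a) * Real.exp (h (v, x) - 1) := by
    rw [← Real.exp_add]
    split_ifs with hlt
    · exact Real.one_le_exp (by linarith [hgh (v, x)])
    · positivity
  calc _ ≤ p x * (q x v * (Real.exp (1 - a) * Real.exp (h (v, x) - 1))) :=
        mul_le_mul_of_nonneg_left (mul_le_mul_of_nonneg_left hind (hq x v)) (hp x)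
    _ = _ := by ring


/-- The divergence-based clipping level: with `M_{ij} = 1 + log(1 + D_{f₁}(i‖j))` and any
lower estimate `r̲ ≤ r`, the `(ε/2)`-upper tail of `r̲` under expert `i` is cut at
`log(2/ε) + M_{ij}`, and (for `ε ≤ 2/e`) also at `2·log(2/ε)·M_{ij}`. -/
theorem stmt_6 {X V : Type*} [Fintype X] [Fintype V] [Nonempty X] [Nonempty V]
    (p : X → ℝ) (hp : ∀ x, 0 < p x) (hp1 : ∑ x, p x = 1)
    (πi πj : X → V → ℝ)
    (hπi0 : ∀ x v, 0 ≤ πi x v) (hπi1 : ∀ x, ∑ v, πi x v = 1)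
    (hπj0 : ∀ x v, 0 < πj x v) (hπj1 : ∀ x, ∑ v, πj x v = 1)
    (r : V × X → ℝ) (hr : ∀ v x, r (v, x) = πi x v / πj x v)
    (f₁ : ℝ → ℝ) (hf₁ : ∀ y, f₁ y = y * Real.exp (y - 1) - 1)
    (D M : ℝ) (hD : D = ∑ x, p x * ∑ v, πj x v * f₁ (r (v, x)))
    (hM : M = 1 + Real.log (1 + D))
    (rlow : V × X → ℝ) (hlow : ∀ vx, rlow vx ≤ r vx)
    (ε : ℝ) (hε : ε ∈ Set.Ioo (0 : ℝ) 1) :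
    (∑ x, p x * ∑ v, πi x v *
        (if Real.log (2 / ε) + M < rlow (v, x) then (1 : ℝ) else 0)) ≤ ε / 2 ∧
    (ε ≤ 2 / Real.exp 1 →
      Real.log (2 / ε) + M ≤ 2 * Real.log (2 / ε) * M ∧
      (∑ x, p x * ∑ v, πi x v *
          (if 2 * Real.log (2 / ε) * M < rlow (v, x) then (1 : ℝ) else 0)) ≤ ε / 2) := by
  obtain ⟨hε0, -⟩ := hε
  set S := ∑ x, p x * ∑ v, πi x v * Real.exp (r (v, x) - 1) with hS
  have hS1 : 1 ≤ S := by
    simpa only [hS, hr] using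
      one_le_expectation_exp_ratio (fun x => (hp x).le) hp1 hπi0 hπi1 hπj0 hπj1
  have hDS : 1 + D = S := by
    have hfibre (x : X) : ∑ v, πj x v * f₁ (r (v, x)) =
        ∑ v, πi x v * Real.exp (r (v, x) - 1) - 1 := by
      nth_rewrite 2 [← hπj1 x]
      rw [← Finset.sum_sub_distrib]
      refine Finset.sum_congr rfl fun v _ => ?_
      have hne := (hπj0 x v).ne'
      rw [hf₁, mul_sub, ← mul_assoc, mul_one, hr, mul_div_cancel₀ _ hne]
    simp only [hD, hfibre, mul_sub, mul_one, Finset.sum_sub_distrib, hp1, hS]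
    ring
  rw [hDS] at hM
  have hSpos : 0 < S := one_pos.trans_le hS1
  have tail (a : ℝ) (ha : Real.log (2 / ε) + M ≤ a) :
      ∑ x, p x * ∑ v, πi x v * (if a < rlow (v, x) then (1 : ℝ) else 0) ≤ ε / 2 := by
    refine (sum_indicator_le_exp_mul_sum (fun x => (hp x).le) hπi0 hlow a).trans ?_
    calc Real.exp (1 - a) * S ≤ Real.exp (-Real.log (2 / ε) - Real.log S) * S := by
          refine mul_le_mul_of_nonneg_right (Real.exp_le_exp.mpr ?_) hSpos.le
          linarith
      _ = ε / 2 := by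
          rw [Real.exp_sub, Real.exp_neg, Real.exp_log (by positivity), Real.exp_log hSpos,
            div_mul_cancel₀ _ hSpos.ne', inv_div]
  refine ⟨tail _ le_rfl, fun hεe => ?_⟩
  have hL : 1 ≤ Real.log (2 / ε) := by
    rw [Real.le_log_iff_exp_le (by positivity), le_div_iff₀ hε0, mul_comm]
    exact (le_div_iff₀ (Real.exp_pos 1)).mp hεe
  have hM1 : 1 ≤ M := by linarith [Real.log_nonneg hS1]
  have hle : Real.log (2 / ε) + M ≤ 2 * Real.log (2 / ε) * M := by nlinarith
  exact ⟨hle, tail _ hle⟩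
end

section
/- Let w : (0,∞) → (0,2) denote the inverse of the function g(y) = y/log(2/y) on (0,2). Let C ≥ 1, M ≥ 1, γ ∈ (0,1), p_V ∈ (0,1) and Δ be real numbers with Δ > γ·p_V, and set δ = Δ − γ·p_V; assume δ < 6C. Then for every integer t ≥ 2 satisfying t/log t ≥ 9·C²·M²·log²(6C/δ) / δ², one has (3C/2)·w( M·√(log t / t) ) + γ·p_V/2 ≤ Δ/2. -/
/-- Deterministic step in the concentration lemma for suboptimal experts: after the
problem-dependent time `τ_k`, the total bias `(3C/2)·w(M·√(log t / t)) + γ·p_V/2` of the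
upper confidence index is at most half the suboptimality gap `Δ`. Here `w` is the
inverse of `g(y) = y / log(2/y)` on `(0,2)`. -/
theorem stmt_10 (w : ℝ → ℝ)
    (hw_mem : ∀ x > (0 : ℝ), w x ∈ Set.Ioo (0 : ℝ) 2)
    (hw_inv : ∀ x > (0 : ℝ), w x / Real.log (2 / w x) = x)
    (C M γ pV Δ δ : ℝ)
    (hC : 1 ≤ C) (hM : 1 ≤ M)
    (hγ : γ ∈ Set.Ioo (0 : ℝ) 1) (hpV : pV ∈ Set.Ioo (0 : ℝ) 1)
    (hΔ : γ * pV < Δ) (hδ : δ = Δ - γ * pV) (hδC : δ < 6 * C) :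
    ∀ t : ℕ, 2 ≤ t →
      9 * C ^ 2 * M ^ 2 * Real.log (6 * C / δ) ^ 2 / δ ^ 2 ≤ (t : ℝ) / Real.log t →
      3 * C / 2 * w (M * Real.sqrt (Real.log t / t)) + γ * pV / 2 ≤ Δ / 2 := by
  intro t ht h
  have hδ0 : 0 < δ := by linarith
  have hC0 : 0 < C := by linarith
  have hM0 : 0 < M := by linarith
  have ht0 : (0 : ℝ) < t := by positivity
  have hlog : 0 < Real.log t := Real.log_pos (by exact_mod_cast ht)
  set L := Real.log (6 * C / δ)
  have hL0 : 0 < L := Real.log_pos ((one_lt_div hδ0).2 hδC)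
  set s := Real.sqrt (Real.log t / t)
  have hs0 : 0 < s := Real.sqrt_pos.2 (by positivity)
  have hs2 : s ^ 2 = Real.log t / t := Real.sq_sqrt (by positivity)
  have hsδ : s * (3 * C * M * L) ≤ δ := by
    refine (sq_le_sq₀ (by positivity) hδ0.le).1 ?_
    rw [div_le_div_iff₀ (by positivity) hlog] at h
    rw [mul_pow, hs2, div_mul_eq_mul_div, div_le_iff₀ ht0]
    linarith
  have hx : 0 < M * s := by positivity
  obtain ⟨hw0, hw2⟩ := hw_mem _ hx
  have hg := hw_inv _ hx
  set y := w (M * s)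
  have hlogy : 0 < Real.log (2 / y) := Real.log_pos ((one_lt_div hw0).2 hw2)
  rw [div_eq_iff hlogy.ne'] at hg
  suffices 3 * C * y ≤ δ by linarith
  by_contra! hy
  have hlt : Real.log (2 / y) < L := by
    refine Real.log_lt_log (by positivity) ?_
    rw [div_lt_div_iff₀ hw0 hδ0]
    linarith
  have := mul_lt_mul_of_pos_left hlt (show 0 < 3 * C * (M * s) by positivity)
  have : 3 * C * y = 3 * C * (M * s) * Real.log (2 / y) := by
    rw [mul_assoc (3 * C), ← hg]
  linarith
end

section
/- Let (Ω, ℱ, P) be a probability space with a filtration (ℱ_s)_{s=0}^{t}. Let γ ∈ (0,1], ε ∈ (0, γ], e ∈ [0, γ/2), M ≥ 1, μ ∈ [γ, 1] and β > 0. For each s ∈ {1,…,t}, let m_s be an ℱ_{s−1}-measurable random variable with 1 ≤ m_s ≤ M almost surely, and let L_s be an ℱ_s-measurable random variable with 0 ≤ L_s ≤ 2·log(2/ε) almost surely, whose conditional mean μ_s = E[L_s | ℱ_{s−1}] satisfies μ − ε/2 − e ≤ μ_s ≤ μ almost surely. Define the normalized weighted average Ỹ = ( Σ_{s=1}^{t}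 L_s/m_s ) / ( Σ_{s=1}^{t} 1/m_s ). Then P( Ỹ ∉ [ (1−β)·(μ − ε/2 − e), (1+β)·μ ] ) ≤ 2·exp( − t·β²·(γ/2 − e)² / (32·M²·log²(2/ε)) ). -/
open MeasureTheory

/-- On `[-B, B]` the exponential lies below its chord. -/
lemma exp_mul_le_cosh_add_mul_sinh {B x : ℝ} (hB : 0 < B) (hx : |x| ≤ B) (l : ℝ) :
    Real.exp (l * x) ≤ Real.cosh (l * B) + x * (Real.sinh (l * B) / B) := by
  obtain ⟨h1, h2⟩ := abs_le.mp hx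
  obtain ⟨-, hconv⟩ := convexOn_exp
  have h := hconv (Set.mem_univ (l * B)) (Set.mem_univ (-(l * B)))
    (a := (B + x) / (2 * B)) (b := (B - x) / (2 * B))
    (div_nonneg (by linarith) (by linarith)) (div_nonneg (by linarith) (by linarith))
    (by field_simp; ring)
  simp only [smul_eq_mul] at h
  have e1 : (B + x) / (2 * B) * (l * B) + (B - x) / (2 * B) * -(l * B) = l * x := by
    field_simp; ring
  rw [e1] at h
  refine h.trans_eq ?_
  rw [Real.cosh_eq, Real.sinh_eq]
  field_simp
  ring

section Supermartingale

variable {Ω : Type*} {m0 : MeasurableSpace Ω} {P : Measure Ω}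

lemma condExp_mul_nonpos {m : MeasurableSpace Ω} {w Z : Ω → ℝ}
    (hw : StronglyMeasurable[m] w) (hw0 : ∀ᵐ ω ∂P, 0 ≤ w ω)
    (hwZ : Integrable (w * Z) P) (hZ : Integrable Z P) (hZ0 : ∀ᵐ ω ∂P, (P[Z | m]) ω ≤ 0) :
    ∀ᵐ ω ∂P, (P[w * Z | m]) ω ≤ 0 := by
  filter_upwards [condExp_mul_of_stronglyMeasurable_left hw hwZ hZ, hw0, hZ0] with ω h h1 h2
  rw [h]
  exact mul_nonpos_of_nonneg_of_nonpos h1 h2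

lemma ae_abs_sum_Icc_le {X : ℕ → Ω → ℝ} {B : ℝ} {n : ℕ}
    (hb : ∀ s ∈ Finset.Icc 1 n, ∀ᵐ ω ∂P, |X s ω| ≤ B) :
    ∀ᵐ ω ∂P, |∑ s ∈ Finset.Icc 1 n, X s ω| ≤ n * B := by
  filter_upwards [(Finset.eventually_all _).2 hb] with ω h
  calc _ ≤ ∑ s ∈ Finset.Icc 1 n, |X s ω| := Finset.abs_sum_le_sum_abs _ _
    _ ≤ ∑ s ∈ Finset.Icc 1 n, B := Finset.sum_le_sum h
    _ = n * B := by simp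

variable [IsProbabilityMeasure P]

lemma integrable_exp_mul_of_abs_le {S : Ω → ℝ} {C : ℝ} (hS : AEStronglyMeasurable S P)
    (hb : ∀ᵐ ω ∂P, |S ω| ≤ C) (l : ℝ) : Integrable (fun ω ↦ Real.exp (l * S ω)) P := by
  refine Integrable.of_bound (C := Real.exp (|l| * C))
    (Real.continuous_exp.comp_aestronglyMeasurable (hS.const_mul l)) ?_
  filter_upwards [hb] with ω h
  rw [Real.norm_eq_abs, Real.abs_exp, Real.exp_le_exp]
  calc l * S ω ≤ |l * S ω| := le_abs_self _
    _ = |l| * |S ω| := abs_mul _ _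
    _ ≤ |l| * C := by gcongr

lemma stronglyMeasurable_sum_Icc {ℱ : Filtration ℕ m0} {X : ℕ → Ω → ℝ} {n : ℕ}
    (hX : ∀ s ∈ Finset.Icc 1 n, StronglyMeasurable[ℱ s] (X s)) :
    StronglyMeasurable[ℱ n] (fun ω ↦ ∑ s ∈ Finset.Icc 1 n, X s ω) :=
  Finset.stronglyMeasurable_fun_sum _ fun s hs ↦
    (hX s hs).mono (ℱ.mono (Finset.mem_Icc.1 hs).2)

/-- Exponential moment bound for a supermartingale with bounded differences. -/
lemma mgf_sum_Icc_le_cosh_pow {ℱ : Filtration ℕ m0} {X : ℕ → Ω → ℝ} {B l : ℝ} (hB : 0 < B)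
    (hl : 0 ≤ l) (n : ℕ)
    (hX : ∀ s ∈ Finset.Icc 1 n, StronglyMeasurable[ℱ s] (X s))
    (hb : ∀ s ∈ Finset.Icc 1 n, ∀ᵐ ω ∂P, |X s ω| ≤ B)
    (hc : ∀ s ∈ Finset.Icc 1 n, ∀ᵐ ω ∂P, (P[X s | ℱ (s - 1)]) ω ≤ 0) :
    ProbabilityTheory.mgf (fun ω ↦ ∑ s ∈ Finset.Icc 1 n, X s ω) P l ≤ Real.cosh (l * B) ^ n := by
  induction n with
  | zero => simp [ProbabilityTheory.mgf]
  | succ n ih =>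
    have hsub : ∀ s ∈ Finset.Icc 1 n, s ∈ Finset.Icc 1 (n + 1) := fun s hs ↦ by
      simp only [Finset.mem_Icc] at hs ⊢; omega
    have hlast : n + 1 ∈ Finset.Icc 1 (n + 1) := by simp
    specialize ih (fun s hs ↦ hX s (hsub s hs)) (fun s hs ↦ hb s (hsub s hs))
      (fun s hs ↦ hc s (hsub s hs))
    have hSm := stronglyMeasurable_sum_Icc (n := n) (fun s hs ↦ hX s (hsub s hs))
    have hSb := ae_abs_sum_Icc_le (n := n) (fun s hs ↦ hb s (hsub s hs))
    have hXm := ((hX _ hlast).mono (ℱ.le _)).aestronglyMeasurable (μ := P)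
    have hXb := hb _ hlast
    have hXc := hc _ hlast
    simp only [Nat.add_sub_cancel] at hXc
    simp only [ProbabilityTheory.mgf] at ih ⊢
    set E : Ω → ℝ := fun ω ↦ Real.exp (l * ∑ s ∈ Finset.Icc 1 n, X s ω) with hE
    have hEm : StronglyMeasurable[ℱ n] E :=
      Real.continuous_exp.comp_stronglyMeasurable (hSm.const_mul l)
    have hEi : Integrable E P :=
      integrable_exp_mul_of_abs_le (hSm.mono (ℱ.le _)).aestronglyMeasurable hSb l
    have hXi : Integrable (X (n + 1)) P := Integrable.of_bound hXm B (by simpa using hXb)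
    have hEXi : Integrable (E * X (n + 1)) P := by
      exact hEi.mul_bdd (c := B) hXm (by simpa using hXb)
    have hneg : ∫ ω, (E * X (n + 1)) ω ∂P ≤ 0 := by
      rw [← integral_condExp (ℱ.le n)]
      exact integral_nonpos_of_ae (condExp_mul_nonpos hEm
        (.of_forall fun ω ↦ (Real.exp_pos _).le) hEXi hXi hXc)
    have hle : ∀ᵐ ω ∂P, Real.exp (l * ∑ s ∈ Finset.Icc 1 (n + 1), X s ω) ≤
        Real.cosh (l * B) * E ω + Real.sinh (l * B) / B * (E * X (n + 1)) ω := by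
      filter_upwards [hXb] with ω h
      rw [Finset.sum_Icc_succ_top (by omega), mul_add, Real.exp_add]
      refine (mul_le_mul_of_nonneg_left (exp_mul_le_cosh_add_mul_sinh hB h l)
        (Real.exp_pos _).le).trans_eq ?_
      simp only [hE, Pi.mul_apply]
      ring
    have hint := (hEi.const_mul (Real.cosh (l * B))).add
      (hEXi.const_mul (Real.sinh (l * B) / B))
    calc _ ≤ ∫ ω, (Real.cosh (l * B) * E ω +
          Real.sinh (l * B) / B * (E * X (n + 1)) ω) ∂P :=
          integral_mono_of_nonneg (.of_forall fun ω ↦ (Real.exp_pos _).le) hint hle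
      _ = Real.cosh (l * B) * ∫ ω, E ω ∂P +
          Real.sinh (l * B) / B * ∫ ω, (E * X (n + 1)) ω ∂P := by
          rw [integral_add (hEi.const_mul _) (hEXi.const_mul _), integral_const_mul,
            integral_const_mul]
      _ ≤ Real.cosh (l * B) * Real.cosh (l * B) ^ n + 0 := by
          refine add_le_add (mul_le_mul_of_nonneg_left ih (Real.cosh_pos _).le) ?_
          exact mul_nonpos_of_nonneg_of_nonpos
            (div_nonneg (Real.sinh_nonneg_iff.2 (by positivity)) hB.le) hneg
      _ = _ := by ring

/-- **Azuma–Hoeffding inequality** for supermartingales with bounded differences. -/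
lemma measureReal_sum_Icc_ge_le {ℱ : Filtration ℕ m0} {X : ℕ → Ω → ℝ} {B x : ℝ} (hB : 0 < B)
    (hx : 0 ≤ x) (n : ℕ)
    (hX : ∀ s ∈ Finset.Icc 1 n, StronglyMeasurable[ℱ s] (X s))
    (hb : ∀ s ∈ Finset.Icc 1 n, ∀ᵐ ω ∂P, |X s ω| ≤ B)
    (hc : ∀ s ∈ Finset.Icc 1 n, ∀ᵐ ω ∂P, (P[X s | ℱ (s - 1)]) ω ≤ 0) :
    P.real {ω | n * x ≤ ∑ s ∈ Finset.Icc 1 n, X s ω} ≤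
      Real.exp (-(n * x ^ 2 / (2 * B ^ 2))) := by
  have hl : 0 ≤ x / B ^ 2 := by positivity
  have hi := integrable_exp_mul_of_abs_le
    ((stronglyMeasurable_sum_Icc hX).mono (ℱ.le n)).aestronglyMeasurable
    (ae_abs_sum_Icc_le hb) (x / B ^ 2)
  refine (ProbabilityTheory.measure_ge_le_exp_mul_mgf (n * x) hl hi).trans ?_
  calc _ ≤ Real.exp (-(x / B ^ 2) * (n * x)) * Real.exp ((x / B ^ 2 * B) ^ 2 / 2) ^ n := by
        gcongr
        exact (mgf_sum_Icc_le_cosh_pow hB hl n hX hb hc).trans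
          (pow_le_pow_left₀ (Real.cosh_pos _).le (Real.cosh_le_exp_half_sq _) n)
    _ = _ := by
        rw [← Real.exp_nat_mul, ← Real.exp_add]
        congr 1
        field_simp
        ring

/-- Azuma–Hoeffding for predictably weighted sums, with weights at most `1`. -/
lemma measureReal_sum_Icc_mul_ge_le {ℱ : Filtration ℕ m0} {w Z : ℕ → Ω → ℝ} {B x : ℝ}
    (hB : 0 < B) (hx : 0 ≤ x) (n : ℕ)
    (hw : ∀ s ∈ Finset.Icc 1 n, StronglyMeasurable[ℱ (s - 1)] (w s))
    (hwb : ∀ s ∈ Finset.Icc 1 n, ∀ᵐ ω ∂P, w s ω ∈ Set.Icc (0 : ℝ) 1)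
    (hZ : ∀ s ∈ Finset.Icc 1 n, StronglyMeasurable[ℱ s] (Z s))
    (hb : ∀ s ∈ Finset.Icc 1 n, ∀ᵐ ω ∂P, |Z s ω| ≤ B)
    (hc : ∀ s ∈ Finset.Icc 1 n, ∀ᵐ ω ∂P, (P[Z s | ℱ (s - 1)]) ω ≤ 0) :
    P.real {ω | n * x ≤ ∑ s ∈ Finset.Icc 1 n, w s ω * Z s ω} ≤
      Real.exp (-(n * x ^ 2 / (2 * B ^ 2))) := by
  have hm : ∀ s ∈ Finset.Icc 1 n, StronglyMeasurable[ℱ s] (w s * Z s) := fun s hs ↦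
    ((hw s hs).mono (ℱ.mono (Nat.sub_le _ _))).mul (hZ s hs)
  have hbd : ∀ s ∈ Finset.Icc 1 n, ∀ᵐ ω ∂P, |(w s * Z s) ω| ≤ B := fun s hs ↦ by
    filter_upwards [hwb s hs, hb s hs] with ω h1 h2
    rw [Pi.mul_apply, abs_mul, abs_of_nonneg h1.1]
    exact (mul_le_of_le_one_left (abs_nonneg _) h1.2).trans h2
  refine measureReal_sum_Icc_ge_le (X := fun s ↦ w s * Z s) hB hx n hm hbd fun s hs ↦ ?_
  refine condExp_mul_nonpos (hw s hs) ((hwb s hs).mono fun ω h ↦ h.1) ?_ ?_ (hc s hs)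
  · exact Integrable.of_bound ((hm s hs).mono (ℱ.le _)).aestronglyMeasurable B
      (by simpa using hbd s hs)
  · exact Integrable.of_bound ((hZ s hs).mono (ℱ.le _)).aestronglyMeasurable B
      (by simpa using hb s hs)

end Supermartingale

/-- Concentration theorem for the empirical clipped importance-sampling estimator
(self-contained form): `L s` are adapted clipped rewards in `[0, 2·log(2/ε)]` whose
conditional means lie in `[μ − ε/2 − e, μ]`, `m s` are predictable divergence weights
in `[1, M]`, and the normalized weighted average `Ỹ` concentrates around `μ`. -/
theorem stmt_11 {Ω : Type*} {m0 : MeasurableSpace Ω} (P : Measure Ω) [IsProbabilityMeasure P]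
    (t : ℕ) (ℱ : Filtration ℕ m0)
    (γ ε e M μ β : ℝ)
    (hγ : γ ∈ Set.Ioc (0 : ℝ) 1) (hε : ε ∈ Set.Ioc (0 : ℝ) γ)
    (he : e ∈ Set.Ico (0 : ℝ) (γ / 2))
    (hM : 1 ≤ M) (hμ : μ ∈ Set.Icc γ 1) (hβ : 0 < β)
    (m L : ℕ → Ω → ℝ)
    (hm_meas : ∀ s ∈ Finset.Icc 1 t, Measurable[ℱ (s - 1)] (m s))
    (hm_bdd : ∀ s ∈ Finset.Icc 1 t, ∀ᵐ ω ∂P, m s ω ∈ Set.Icc (1 : ℝ) M)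
    (hL_meas : ∀ s ∈ Finset.Icc 1 t, Measurable[ℱ s] (L s))
    (hL_bdd : ∀ s ∈ Finset.Icc 1 t, ∀ᵐ ω ∂P,
      L s ω ∈ Set.Icc (0 : ℝ) (2 * Real.log (2 / ε)))
    (hmean : ∀ s ∈ Finset.Icc 1 t, ∀ᵐ ω ∂P,
      (P[L s | ℱ (s - 1)]) ω ∈ Set.Icc (μ - ε / 2 - e) μ) :
    (P {ω | (∑ s ∈ Finset.Icc 1 t, L s ω / m s ω) /
          (∑ s ∈ Finset.Icc 1 t, 1 / m s ω) ∉
        Set.Icc ((1 - β) * (μ - ε / 2 - e)) ((1 + β) * μ)}).toReal ≤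
      2 * Real.exp (-(t : ℝ) * β ^ 2 * (γ / 2 - e) ^ 2 /
        (32 * M ^ 2 * Real.log (2 / ε) ^ 2)) := by
  obtain ⟨hγ0, hγ1⟩ := hγ
  obtain ⟨hε0, hεγ⟩ := hε
  obtain ⟨he0, heγ⟩ := he
  obtain ⟨hμγ, hμ1⟩ := hμ
  rcases Nat.eq_zero_or_pos t with rfl | ht
  · refine (measureReal_le_one (μ := P)).trans ?_
    norm_num
  set ν := μ - ε / 2 - e with hν
  set δ := γ / 2 - e with hδ
  have hδ0 : 0 < δ := by linarith
  have hδν : δ ≤ ν := by linarith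
  have hνμ : ν ≤ μ := by linarith
  have hlog : 1 / 2 ≤ Real.log (2 / ε) := by
    have h1 : Real.log 2 ≤ Real.log (2 / ε) := by
      apply Real.log_le_log (by norm_num)
      rw [le_div_iff₀ hε0]
      linarith
    linarith [Real.log_two_gt_d9]
  set l := Real.log (2 / ε) with hl
  have hB : 0 < 2 * l := by linarith
  set x := β * δ / M with hx
  have hM0 : 0 < M := by linarith
  have ht0 : (0 : ℝ) < t := by exact_mod_cast ht
  have hx0 : 0 ≤ x := by positivity
  have hw : ∀ s ∈ Finset.Icc 1 t, StronglyMeasurable[ℱ (s - 1)] (fun ω ↦ (m s ω)⁻¹) :=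
    fun s hs ↦ (hm_meas s hs).inv.stronglyMeasurable
  have hwb : ∀ s ∈ Finset.Icc 1 t, ∀ᵐ ω ∂P, (m s ω)⁻¹ ∈ Set.Icc (0 : ℝ) 1 := fun s hs ↦ by
    filter_upwards [hm_bdd s hs] with ω h
    exact ⟨inv_nonneg.2 (by linarith [h.1]), inv_le_one_of_one_le₀ h.1⟩
  have hLm : ∀ s ∈ Finset.Icc 1 t, StronglyMeasurable[ℱ s] (L s) :=
    fun s hs ↦ (hL_meas s hs).stronglyMeasurable
  have hLi : ∀ s ∈ Finset.Icc 1 t, Integrable (L s) P := fun s hs ↦ by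
    refine Integrable.of_bound ((hLm s hs).mono (ℱ.le _)).aestronglyMeasurable (2 * l) ?_
    filter_upwards [hL_bdd s hs] with ω h
    rw [Real.norm_eq_abs, abs_of_nonneg h.1]
    exact h.2
  have hup := measureReal_sum_Icc_mul_ge_le (P := P) (ℱ := ℱ) (w := fun s ω ↦ (m s ω)⁻¹)
    (Z := fun s ↦ L s - fun _ ↦ μ) hB hx0 t hw hwb
    (fun s hs ↦ (hLm s hs).sub stronglyMeasurable_const)
    (fun s hs ↦ by
      filter_upwards [hL_bdd s hs] with ω h
      simp only [Pi.sub_apply]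
      rw [abs_le]
      constructor <;> linarith [h.1, h.2])
    (fun s hs ↦ by
      filter_upwards [hmean s hs,
        condExp_sub (hLi s hs) (integrable_const μ) (ℱ (s - 1))] with ω h h'
      rw [h', Pi.sub_apply, condExp_const (ℱ.le _)]
      linarith [h.2])
  have hlo := measureReal_sum_Icc_mul_ge_le (P := P) (ℱ := ℱ) (w := fun s ω ↦ (m s ω)⁻¹)
    (Z := fun s ↦ (fun _ ↦ ν) - L s) hB hx0 t hw hwb
    (fun s hs ↦ stronglyMeasurable_const.sub (hLm s hs))
    (fun s hs ↦ by
      filter_upwards [hL_bdd s hs] with ω h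
      simp only [Pi.sub_apply]
      rw [abs_le]
      constructor <;> linarith [h.1, h.2])
    (fun s hs ↦ by
      filter_upwards [hmean s hs,
        condExp_sub (integrable_const ν) (hLi s hs) (ℱ (s - 1))] with ω h h'
      rw [h', Pi.sub_apply, condExp_const (ℱ.le _)]
      linarith [h.1])
  simp only [Pi.sub_apply] at hup hlo
  have hexp : Real.exp (-(t * x ^ 2 / (2 * (2 * l) ^ 2))) ≤
      Real.exp (-(t : ℝ) * β ^ 2 * δ ^ 2 / (32 * M ^ 2 * l ^ 2)) := by
    have hl0 : 0 < l := by linarith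
    have h1 : -(t * x ^ 2 / (2 * (2 * l) ^ 2)) =
        4 * (-(t : ℝ) * β ^ 2 * δ ^ 2 / (32 * M ^ 2 * l ^ 2)) := by
      rw [hx]
      field_simp
      ring
    have h2 : -(t : ℝ) * β ^ 2 * δ ^ 2 / (32 * M ^ 2 * l ^ 2) ≤ 0 := by
      rw [neg_mul, neg_mul, neg_div]
      exact neg_nonpos.2 (by positivity)
    rw [Real.exp_le_exp, h1]
    linarith
  rw [two_mul (Real.exp _)]
  refine le_trans ?_ (add_le_add (hup.trans hexp) (hlo.trans hexp))
  refine le_trans ?_ (measureReal_union_le (μ := P) _ _)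
  refine ENNReal.toReal_mono (measure_ne_top _ _) (measure_mono_ae ?_)
  filter_upwards [(Finset.eventually_all _).2 hm_bdd] with ω hmω hω
  have hW : t / M ≤ ∑ s ∈ Finset.Icc 1 t, (m s ω)⁻¹ := by
    have := Finset.card_nsmul_le_sum (Finset.Icc 1 t) (fun s ↦ (m s ω)⁻¹) M⁻¹
      fun s hs ↦ inv_anti₀ (by linarith [(hmω s hs).1]) (hmω s hs).2
    simpa [div_eq_mul_inv] using this
  have hW0 : 0 < ∑ s ∈ Finset.Icc 1 t, (m s ω)⁻¹ := lt_of_lt_of_le (by positivity) hW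
  have htx : ∀ c, δ ≤ c → t * x ≤ β * c * ∑ s ∈ Finset.Icc 1 t, (m s ω)⁻¹ := fun c hc ↦
    calc t * x = β * δ * (t / M) := by rw [hx]; ring
      _ ≤ _ := by
        have hc0 : 0 ≤ c := hδ0.le.trans hc
        gcongr
  change _ ∉ Set.Icc _ _ at hω
  simp only [one_div, Set.mem_Icc, not_and_or, not_le, div_lt_iff₀ hW0, lt_div_iff₀ hW0] at hω
  have hsum : ∑ s ∈ Finset.Icc 1 t, L s ω / m s ω = ∑ s ∈ Finset.Icc 1 t, (m s ω)⁻¹ * L s ω :=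
    Finset.sum_congr rfl fun s _ ↦ by rw [div_eq_inv_mul]
  rw [hsum] at hω
  rcases hω with h | h
  · right
    change t * x ≤ _
    simp only [mul_sub, Finset.sum_sub_distrib, ← Finset.sum_mul]
    linarith [htx ν hδν]
  · left
    change t * x ≤ _
    simp only [mul_sub, Finset.sum_sub_distrib, ← Finset.sum_mul]
    linarith [htx μ (hδν.trans hνμ)]
end

section
/- Let N ≥ 2 and T be positive integers, let Δ_1 = 0 and let Δ_2 ≤ Δ_3 ≤ … ≤ Δ_N be nonnegative reals, and let T_2 ≥ T_3 ≥ … ≥ T_N ≥ 1 be positive integers with T ≥ T_2. Let k_1, …, k_T be random variables taking values in {1,…,N} on a probability space, and suppose that for every k ∈ {2,…,N} and every t ≥ T_k one has P(k_t = k) ≤ 2/t². Then Σ_{t=1}^{T} E[Δ_{k_t}] ≤ (π²/3)·Σ_{k=2}^{N} Δ_k + T_N·Δ_N + Σ_{k=2}^{N−1} (T_k − T_{k+1})·Δ_k. -/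
open MeasureTheory

/-- The regret at time `t` charged to experts whose time `Tk` has not passed: it is `Δ N` before
time `Tk N` and `Δ k` on `[Tk (k + 1), Tk k)`. -/
noncomputable def burnInRegret (N : ℕ) (Δ : ℕ → ℝ) (Tk : ℕ → ℕ) (t : ℕ) : ℝ :=
  (if t < Tk N then Δ N else 0) +
    ∑ k ∈ Finset.Icc 2 (N - 1), if t ∈ Finset.Ico (Tk (k + 1)) (Tk k) then Δ k else 0

theorem burnInRegret_sum_nonneg {N : ℕ} {Δ : ℕ → ℝ} (hΔ : ∀ k ∈ Finset.Icc 2 N, 0 ≤ Δ k)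
    (Tk : ℕ → ℕ) (t : ℕ) : ∀ k ∈ Finset.Icc 2 (N - 1),
      0 ≤ if t ∈ Finset.Ico (Tk (k + 1)) (Tk k) then Δ k else 0 := by
  intro k hk
  rw [Finset.mem_Icc] at hk
  split_ifs
  · exact hΔ k (Finset.mem_Icc.2 (by omega))
  · exact le_rfl

theorem burnInRegret_nonneg {N : ℕ} (hN : 2 ≤ N) {Δ : ℕ → ℝ}
    (hΔ : ∀ k ∈ Finset.Icc 2 N, 0 ≤ Δ k) (Tk : ℕ → ℕ) (t : ℕ) :
    0 ≤ burnInRegret N Δ Tk t := by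
  refine add_nonneg ?_ (Finset.sum_nonneg (burnInRegret_sum_nonneg hΔ Tk t))
  split_ifs
  · exact hΔ N (Finset.mem_Icc.2 ⟨hN, le_rfl⟩)
  · exact le_rfl

theorem le_burnInRegret {N : ℕ} (hN : 2 ≤ N) {Δ : ℕ → ℝ}
    (hΔ : ∀ k ∈ Finset.Icc 2 N, 0 ≤ Δ k)
    (hmono : ∀ k, 2 ≤ k → k + 1 ≤ N → Δ k ≤ Δ (k + 1)) (Tk : ℕ → ℕ) {t k : ℕ}
    (hk : 2 ≤ k) (hkN : k ≤ N) (ht : t < Tk k) : Δ k ≤ burnInRegret N Δ Tk t := by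
  obtain ⟨d, rfl⟩ := Nat.exists_eq_add_of_le hkN
  induction d generalizing k with
  | zero =>
    unfold burnInRegret
    have := Finset.sum_nonneg (burnInRegret_sum_nonneg hΔ Tk t)
    rw [if_pos (by simpa using ht)]
    simpa using this
  | succ d ih =>
    by_cases h : t < Tk (k + 1)
    · have e : k + (d + 1) = k + 1 + d := by omega
      rw [e] at hN hΔ hmono ⊢
      exact (hmono k hk (by omega)).trans
        (ih (by omega) h hN hΔ hmono (by omega))
    · have h1 := Finset.single_le_sum (burnInRegret_sum_nonneg hΔ Tk t)
        (Finset.mem_Icc.2 (⟨hk, by omega⟩ : 2 ≤ k ∧ k ≤ k + (d + 1) - 1))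
      rw [if_pos (Finset.mem_Ico.2 ⟨not_lt.1 h, ht⟩)] at h1
      have h2 := hΔ (k + (d + 1)) (Finset.mem_Icc.2 ⟨hN, le_rfl⟩)
      unfold burnInRegret
      split_ifs <;> linarith

theorem sum_ite_mem_le_card_mul (s A : Finset ℕ) {c : ℝ} (hc : 0 ≤ c) :
    ∑ t ∈ s, (if t ∈ A then c else 0) ≤ A.card * c := by
  rw [← Finset.sum_filter, Finset.sum_const, nsmul_eq_mul]
  gcongr
  intro t ht
  exact (Finset.mem_filter.1 ht).2

theorem sum_burnInRegret_le {N : ℕ} (hN : 2 ≤ N) {Δ : ℕ → ℝ}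
    (hΔ : ∀ k ∈ Finset.Icc 2 N, 0 ≤ Δ k) {Tk : ℕ → ℕ}
    (hTk : ∀ k, 2 ≤ k → k + 1 ≤ N → Tk (k + 1) ≤ Tk k) (s : Finset ℕ) :
    ∑ t ∈ s, burnInRegret N Δ Tk t ≤ (Tk N : ℝ) * Δ N +
      ∑ k ∈ Finset.Icc 2 (N - 1), ((Tk k : ℝ) - (Tk (k + 1) : ℝ)) * Δ k := by
  unfold burnInRegret
  rw [Finset.sum_add_distrib, Finset.sum_comm]
  refine add_le_add ?_ (Finset.sum_le_sum fun k hk => ?_)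
  · simpa using sum_ite_mem_le_card_mul s (Finset.range (Tk N))
      (hΔ N (Finset.mem_Icc.2 ⟨hN, le_rfl⟩))
  · rw [Finset.mem_Icc] at hk
    have := sum_ite_mem_le_card_mul s (Finset.Ico (Tk (k + 1)) (Tk k))
      (hΔ k (Finset.mem_Icc.2 (by omega)))
    rwa [Nat.card_Ico, Nat.cast_sub (hTk k hk.1 (by omega))] at this

theorem sum_two_div_sq_le (s : Finset ℕ) : ∑ t ∈ s, 2 / (t : ℝ) ^ 2 ≤ Real.pi ^ 2 / 3 := by
  have h := sum_le_hasSum s (fun t _ => by positivity) (hasSum_zeta_two.mul_left 2)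
  calc ∑ t ∈ s, 2 / (t : ℝ) ^ 2 = ∑ t ∈ s, 2 * (1 / (t : ℝ) ^ 2) := by simp [div_eq_mul_inv]
    _ ≤ 2 * (Real.pi ^ 2 / 6) := h
    _ = Real.pi ^ 2 / 3 := by ring

/-- If each level `k` satisfies `Δ k ≤ B` or is reached with probability at most `c`, then
`E[Δ X] ≤ B + c * ∑ Δ`. -/
theorem integral_comp_le_add_mul_sum {Ω : Type*} [MeasurableSpace Ω] (P : Measure Ω)
    [IsProbabilityMeasure P] {N : ℕ} {Δ : ℕ → ℝ} (hΔ1 : Δ 1 = 0)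
    (hΔ : ∀ k ∈ Finset.Icc 2 N, 0 ≤ Δ k) {X : Ω → ℕ} (hX : Measurable X)
    (hXN : ∀ ω, X ω ∈ Finset.Icc 1 N) {B c : ℝ} (hB : 0 ≤ B) (hc : 0 ≤ c)
    (h : ∀ k ∈ Finset.Icc 2 N, Δ k ≤ B ∨ P.real {ω | X ω = k} ≤ c) :
    ∫ ω, Δ (X ω) ∂P ≤ B + c * ∑ k ∈ Finset.Icc 2 N, Δ k := by
  classical
  set S := (Finset.Icc 2 N).filter fun k => ¬ Δ k ≤ B with hS
  have hSN : S ⊆ Finset.Icc 2 N := Finset.filter_subset _ _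
  have hmeas (k : ℕ) : MeasurableSet {ω | X ω = k} := hX (measurableSet_singleton k)
  have hcases (ω : Ω) : X ω = 1 ∨ X ω ∈ Finset.Icc 2 N := by
    have := hXN ω
    simp only [Finset.mem_Icc] at this ⊢
    omega
  have hint (k : ℕ) : Integrable ({ω | X ω = k}.indicator fun _ => Δ k) P :=
    (integrable_const _).indicator (hmeas k)
  have hind (ω : Ω) : ∀ k ∈ S, 0 ≤ {ω | X ω = k}.indicator (fun _ => Δ k) ω :=
    fun k hk => Set.indicator_nonneg (fun _ _ => hΔ k (hSN hk)) ω
  calc ∫ ω, Δ (X ω) ∂P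
      ≤ ∫ ω, (B + ∑ k ∈ S, {ω | X ω = k}.indicator (fun _ => Δ k) ω) ∂P := by
        refine integral_mono_of_nonneg (.of_forall fun ω => ?_)
          ((integrable_const B).add (integrable_finsetSum S fun k _ => hint k))
          (.of_forall fun ω => ?_)
        · rcases hcases ω with h1 | h1
          · simp [h1, hΔ1]
          · exact hΔ _ h1
        · have hsum := Finset.sum_nonneg (hind ω)
          dsimp only
          rcases hcases ω with h1 | h1
          · rw [h1, hΔ1]
            exact add_nonneg hB (by simpa [h1] using hsum)
          · by_cases h2 : Δ (X ω) ≤ B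
            · linarith
            · have h3 := Finset.single_le_sum (hind ω)
                (Finset.mem_filter.2 ⟨h1, h2⟩ : X ω ∈ S)
              rw [Set.indicator_of_mem (by rfl)] at h3
              linarith
    _ = B + ∑ k ∈ S, P.real {ω | X ω = k} * Δ k := by
        rw [integral_add (integrable_const B) (integrable_finsetSum S fun k _ => hint k),
          integral_finsetSum S fun k _ => hint k]
        simp [integral_indicator_const, hmeas]
    _ ≤ B + ∑ k ∈ S, c * Δ k := by
        gcongr with k hk
        · exact hΔ k (hSN hk)
        · exact (h k (hSN hk)).resolve_left (Finset.mem_filter.1 hk).2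
    _ ≤ B + c * ∑ k ∈ Finset.Icc 2 N, Δ k := by
        rw [Finset.mul_sum]
        gcongr
        exact fun k hk _ => mul_nonneg hc (hΔ k hk)

/-- Regret decomposition for the main single-episode theorem: if after time `T_k` each
suboptimal expert `k` is played with probability at most `2/t²`, then the expected
cumulative regret is bounded by the problem-dependent constant
`(π²/3)·Σ_k Δ_k + T_N·Δ_N + Σ_{k=2}^{N−1} (T_k − T_{k+1})·Δ_k`. -/
theorem stmt_13 {Ω : Type*} [MeasurableSpace Ω] (P : Measure Ω) [IsProbabilityMeasure P]
    (N T : ℕ) (hN : 2 ≤ N) (hT : 0 < T)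
    (Δ : ℕ → ℝ) (hΔ1 : Δ 1 = 0)
    (hΔ_nonneg : ∀ k ∈ Finset.Icc 2 N, 0 ≤ Δ k)
    (hΔ_mono : ∀ k, 2 ≤ k → k + 1 ≤ N → Δ k ≤ Δ (k + 1))
    (Tk : ℕ → ℕ)
    (hTk_mono : ∀ k, 2 ≤ k → k + 1 ≤ N → Tk (k + 1) ≤ Tk k)
    (hTkN : 1 ≤ Tk N) (hTT2 : Tk 2 ≤ T)
    (kch : ℕ → Ω → ℕ) (hkch_meas : ∀ t, Measurable (kch t))
    (hkch_range : ∀ t ∈ Finset.Icc 1 T, ∀ ω, kch t ω ∈ Finset.Icc 1 N)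
    (hprob : ∀ k ∈ Finset.Icc 2 N, ∀ t : ℕ, Tk k ≤ t →
      (P {ω | kch t ω = k}).toReal ≤ 2 / (t : ℝ) ^ 2) :
    ∑ t ∈ Finset.Icc 1 T, ∫ ω, Δ (kch t ω) ∂P ≤
      Real.pi ^ 2 / 3 * ∑ k ∈ Finset.Icc 2 N, Δ k +
        (Tk N : ℝ) * Δ N +
        ∑ k ∈ Finset.Icc 2 (N - 1), ((Tk k : ℝ) - (Tk (k + 1) : ℝ)) * Δ k := by
  calc ∑ t ∈ Finset.Icc 1 T, ∫ ω, Δ (kch t ω) ∂P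
      ≤ ∑ t ∈ Finset.Icc 1 T,
          (burnInRegret N Δ Tk t + 2 / (t : ℝ) ^ 2 * ∑ k ∈ Finset.Icc 2 N, Δ k) := by
        refine Finset.sum_le_sum fun t ht => integral_comp_le_add_mul_sum P hΔ1 hΔ_nonneg
          (hkch_meas t) (hkch_range t ht) (burnInRegret_nonneg hN hΔ_nonneg Tk t)
          (by positivity) fun k hk => ?_
        have hk2 := Finset.mem_Icc.1 hk
        exact (lt_or_ge t (Tk k)).imp
          (le_burnInRegret hN hΔ_nonneg hΔ_mono Tk hk2.1 hk2.2) (hprob k hk t)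
    _ = ∑ t ∈ Finset.Icc 1 T, burnInRegret N Δ Tk t +
          (∑ t ∈ Finset.Icc 1 T, 2 / (t : ℝ) ^ 2) * ∑ k ∈ Finset.Icc 2 N, Δ k := by
        rw [Finset.sum_add_distrib, Finset.sum_mul]
    _ ≤ _ := by
        have h1 := sum_burnInRegret_le hN hΔ_nonneg hTk_mono (Finset.Icc 1 T)
        have h2 := mul_le_mul_of_nonneg_right (sum_two_div_sq_le (Finset.Icc 1 T))
          (Finset.sum_nonneg hΔ_nonneg)
        linarith
end
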